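/- arXiv:1901.00913 — 5 statements merged into one kernel-verified Lean document; each statement's English description precedes it below -/
import Mathlib

section
/- Let A ∈ ℝ^{N×N}, b ∈ ℝ^N, λ ≠ 0, and let L ≥ ‖A‖₂² (the square of the operator norm of A). Let x* be the unique minimizer of the Tikhonov functional Φ. Given x₀ ∈ ℝ^N, define the FISTA sequences by y₁ = x₀, t₁ = 1, and for k ≥ 1: x_k = (1/(L+λ²))(L y_k − Aᵀ(A y_k − b)), t_{k+1} = (1+√(1+4 t_k²))/2, y_{k+1} = x_k + ((t_k−1)/t_{k+1})(x_k − x_{k−1}) (with x₋ terms starting from x₀). Then for every k ≥ 1, Φ(x_k) − Φ(x*) ≤ 2L‖x₀ − x*‖₂²/(k+1)². -/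
open Matrix
noncomputable section

/-- Multiplication of a matrix with a vector of `EuclideanSpace ℝ (Fin N)`. -/
def mulVecE {N : ℕ} (A : Matrix (Fin N) (Fin N) ℝ) (x : EuclideanSpace ℝ (Fin N)) :
    EuclideanSpace ℝ (Fin N) :=
  (WithLp.equiv 2 (Fin N → ℝ)).symm (A.mulVec ((WithLp.equiv 2 (Fin N → ℝ)) x))

/-- The operator 2-norm of a matrix, induced by the Euclidean norms. -/
def opNorm {N : ℕ} (A : Matrix (Fin N) (Fin N) ℝ) : ℝ :=
  ‖Matrix.toEuclideanCLM (𝕜 := ℝ) A‖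

open scoped RealInnerProductSpace in
/-- The fundamental inequality of one proximal gradient step on the Tikhonov functional. -/
theorem tikhonov_prox_step_le {E F : Type*} [NormedAddCommGroup E] [InnerProductSpace ℝ E]
    [NormedAddCommGroup F] [InnerProductSpace ℝ F] (T : E →L[ℝ] F) (b : F) {L lam : ℝ}
    (hL : ‖T‖ ^ 2 ≤ L) {x y g : E} (hg : ∀ w, ⟪g, w⟫ = ⟪T y - b, T w⟫)
    (hx : (L + lam ^ 2) • x = L • y - g) (z : E) :
    1 / 2 * ‖T x - b‖ ^ 2 + lam ^ 2 / 2 * ‖x‖ ^ 2 + L / 2 * ‖z - x‖ ^ 2 ≤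
      1 / 2 * ‖T z - b‖ ^ 2 + lam ^ 2 / 2 * ‖z‖ ^ 2 + L / 2 * ‖z - y‖ ^ 2 := by
  have residual (w : E) : ‖T w - b‖ ^ 2 =
      ‖T y - b‖ ^ 2 + 2 * (⟪g, w⟫ - ⟪g, y⟫) + ‖T (w - y)‖ ^ 2 := by
    rw [← inner_sub_right, hg, ← norm_add_sq_real, map_sub]
    congr 2
    abel
  have bound : ‖T (x - y)‖ ^ 2 ≤ L * ‖x - y‖ ^ 2 := by
    calc ‖T (x - y)‖ ^ 2 ≤ (‖T‖ * ‖x - y‖) ^ 2 := by gcongr; exact T.le_opNorm _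
      _ = ‖T‖ ^ 2 * ‖x - y‖ ^ 2 := mul_pow _ _ _
      _ ≤ _ := by gcongr
  have step (w : E) : (L + lam ^ 2) * ⟪x, w⟫ = L * ⟪y, w⟫ - ⟪g, w⟫ := by
    rw [← real_inner_smul_left, hx, inner_sub_left, real_inner_smul_left]
  have stepx := step x
  have stepz := step z
  have strong : 0 ≤ lam ^ 2 * ‖z - x‖ ^ 2 := by positivity
  have image := sq_nonneg ‖T (z - y)‖
  rw [residual x, residual z]
  simp only [norm_sub_sq_real] at bound strong ⊢
  rw [real_inner_self_eq_norm_sq] at stepx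
  rw [real_inner_comm x z] at strong ⊢
  rw [real_inner_comm y z]
  rw [real_inner_comm x y] at stepx
  linarith

/-- Combining the distances to two points with weights `t - 1` and `1`. -/
theorem mul_weighted_sq_dist_sub {E : Type*} [NormedAddCommGroup E] [InnerProductSpace ℝ E]
    (t : ℝ) (p q x y : E) :
    t * ((t - 1) * (‖p - y‖ ^ 2 - ‖p - x‖ ^ 2) + (‖q - y‖ ^ 2 - ‖q - x‖ ^ 2)) =
      ‖t • y - (t - 1) • p - q‖ ^ 2 - ‖t • x - (t - 1) • p - q‖ ^ 2 := by
  simp only [norm_sub_sq_real, inner_sub_left, real_inner_smul_left, real_inner_smul_right,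
    norm_smul, mul_pow, Real.norm_eq_abs, sq_abs]
  rw [real_inner_comm y p, real_inner_comm x p, real_inner_comm y q, real_inner_comm x q]
  ring

theorem fista_step_sq_sub {s t : ℝ} (h : t = (1 + Real.sqrt (1 + 4 * s ^ 2)) / 2) :
    t ^ 2 - t = s ^ 2 := by
  have := Real.sq_sqrt (show (0 : ℝ) ≤ 1 + 4 * s ^ 2 by positivity)
  rw [h]
  linarith

theorem fista_step_lower_bound {t : ℕ → ℝ} (ht1 : t 1 = 1)
    (ht : ∀ k ≥ 1, t (k + 1) = (1 + Real.sqrt (1 + 4 * t k ^ 2)) / 2) :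
    ∀ k : ℕ, 1 ≤ k → ((k : ℝ) + 1) / 2 ≤ t k := by
  intro k hk
  induction k, hk using Nat.le_induction with
  | base => norm_num [ht1]
  | succ k hk ih =>
    have : 2 * t k ≤ Real.sqrt (1 + 4 * t k ^ 2) := Real.le_sqrt_of_sq_le (by linarith)
    rw [ht k hk]
    push_cast
    linarith

/-- The Lyapunov estimate of FISTA for any objective satisfying the proximal gradient
inequality along the iteration. -/
theorem fista_lyapunov {E : Type*} [NormedAddCommGroup E] [InnerProductSpace ℝ E]
    {Φ : E → ℝ} {L : ℝ} {q : E} {x y : ℕ → E} {t : ℕ → ℝ}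
    (hprox : ∀ k ≥ 1, ∀ z, Φ (x k) + L / 2 * ‖z - x k‖ ^ 2 ≤ Φ z + L / 2 * ‖z - y k‖ ^ 2)
    (hy1 : y 1 = x 0) (ht1 : t 1 = 1)
    (ht : ∀ k ≥ 1, t (k + 1) = (1 + Real.sqrt (1 + 4 * t k ^ 2)) / 2)
    (hy : ∀ k ≥ 1, y (k + 1) = x k + ((t k - 1) / t (k + 1)) • (x k - x (k - 1))) :
    ∀ k ≥ 1, t k ^ 2 * (Φ (x k) - Φ q) +
      L / 2 * ‖t k • x k - (t k - 1) • x (k - 1) - q‖ ^ 2 ≤ L / 2 * ‖x 0 - q‖ ^ 2 := by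
  intro k hk
  induction k, hk using Nat.le_induction with
  | base =>
    have := hprox 1 le_rfl q
    rw [hy1, norm_sub_rev q, norm_sub_rev q] at this
    simp only [ht1, sub_self, one_smul, zero_smul, sub_zero]
    linarith
  | succ k hk ih =>
    have lower := fista_step_lower_bound ht1 ht (k + 1) (by omega)
    have one_le : 1 ≤ t (k + 1) := by
      have : (1 : ℝ) ≤ k := by exact_mod_cast hk
      push_cast at lower
      linarith
    have extrapolation : t (k + 1) • y (k + 1) - (t (k + 1) - 1) • x k - q =
        t k • x k - (t k - 1) • x (k - 1) - q := by
      rw [hy k hk, smul_add, smul_smul, mul_div_cancel₀ _ (by linarith)]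
      module
    have combine := mul_weighted_sq_dist_sub (t (k + 1)) (x k) q (x (k + 1)) (y (k + 1))
    rw [extrapolation] at combine
    have recurrence := fista_step_sq_sub (ht k hk)
    have to_prev := mul_le_mul_of_nonneg_left (hprox (k + 1) (by omega) (x k))
      (show 0 ≤ t (k + 1) * (t (k + 1) - 1) by nlinarith)
    have to_min := mul_le_mul_of_nonneg_left (hprox (k + 1) (by omega) q)
      (show 0 ≤ t (k + 1) by linarith)
    rw [← recurrence] at ih
    rw [Nat.add_sub_cancel]
    linear_combination ih + to_prev + to_min + L / 2 * combine

theorem mulVecE_eq_toEuclideanCLM {N : ℕ} (A : Matrix (Fin N) (Fin N) ℝ)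
    (x : EuclideanSpace ℝ (Fin N)) :
    mulVecE A x = Matrix.toEuclideanCLM (𝕜 := ℝ) A x := rfl

theorem inner_mulVecE_transpose {N : ℕ} (A : Matrix (Fin N) (Fin N) ℝ)
    (v w : EuclideanSpace ℝ (Fin N)) :
    inner ℝ (mulVecE Aᵀ v) w = inner ℝ v (mulVecE A w) := by
  simp only [mulVecE, EuclideanSpace.inner_eq_star_dotProduct, WithLp.equiv_apply,
    WithLp.equiv_symm_apply, star_trivial, Matrix.mulVec_transpose]
  rw [dotProduct_comm, ← Matrix.dotProduct_mulVec, dotProduct_comm]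

/-- FISTA convergence for the Tikhonov functional
`Φ(x) = ½‖Ax−b‖² + (λ²/2)‖x‖²`: for every `k ≥ 1`,
`Φ(x_k) − Φ(x*) ≤ 2L‖x₀ − x*‖²/(k+1)²`. -/
theorem fista_tikhonov_convergence {N : ℕ}
    (A : Matrix (Fin N) (Fin N) ℝ) (b : EuclideanSpace ℝ (Fin N))
    (lam L : ℝ) (hlam : lam ≠ 0) (hL : opNorm A ^ 2 ≤ L)
    (Φ : EuclideanSpace ℝ (Fin N) → ℝ)
    (hΦ : ∀ z, Φ z = 1 / 2 * ‖mulVecE A z - b‖ ^ 2 + lam ^ 2 / 2 * ‖z‖ ^ 2)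
    (xstar : EuclideanSpace ℝ (Fin N)) (hxstar : ∀ z, Φ xstar ≤ Φ z)
    (x y : ℕ → EuclideanSpace ℝ (Fin N)) (t : ℕ → ℝ)
    (hy1 : y 1 = x 0) (ht1 : t 1 = 1)
    (hx : ∀ k ≥ 1, x k = (1 / (L + lam ^ 2)) •
      (L • y k - mulVecE Aᵀ (mulVecE A (y k) - b)))
    (ht : ∀ k ≥ 1, t (k + 1) = (1 + Real.sqrt (1 + 4 * t k ^ 2)) / 2)
    (hy : ∀ k ≥ 1, y (k + 1) = x k + ((t k - 1) / t (k + 1)) • (x k - x (k - 1))) :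
    ∀ k ≥ 1, Φ (x k) - Φ xstar ≤ 2 * L * ‖x 0 - xstar‖ ^ 2 / ((k : ℝ) + 1) ^ 2 := by
  intro k hk
  have hL0 : 0 ≤ L := (sq_nonneg _).trans hL
  have hprox : ∀ k ≥ 1, ∀ z,
      Φ (x k) + L / 2 * ‖z - x k‖ ^ 2 ≤ Φ z + L / 2 * ‖z - y k‖ ^ 2 := by
    intro k hk z
    rw [hΦ, hΦ]
    refine tikhonov_prox_step_le (Matrix.toEuclideanCLM (𝕜 := ℝ) A) b hL
      (g := mulVecE Aᵀ (mulVecE A (y k) - b)) (fun w => inner_mulVecE_transpose _ _ _) ?_ z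
    have : L + lam ^ 2 ≠ 0 := by positivity
    rw [hx k hk, smul_smul, mul_one_div_cancel this, one_smul]
  have lyapunov := fista_lyapunov (q := xstar) hprox hy1 ht1 ht hy k hk
  have lower := fista_step_lower_bound ht1 ht k hk
  have gap : 0 ≤ Φ (x k) - Φ xstar := sub_nonneg.2 (hxstar _)
  have weight : (((k : ℝ) + 1) / 2) ^ 2 * (Φ (x k) - Φ xstar) ≤
      t k ^ 2 * (Φ (x k) - Φ xstar) := by gcongr
  have rest : 0 ≤ L / 2 * ‖t k • x k - (t k - 1) • x (k - 1) - xstar‖ ^ 2 := by positivity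
  rw [le_div_iff₀ (by positivity)]
  linarith
end
end

section
/- Let A, A_s ∈ ℝ^{N×N}, b ∈ ℝ^N, λ ∈ ℝ, and suppose x*, x_s* ∈ ℝ^N satisfy Aᵀ(Ax* − b) + λ²x* = 0 and A_sᵀ(A_s x_s* − b) + λ²x_s* = 0. If the matrix AᵀA_s + λ²I is invertible, then ‖x_s* − x*‖₂ ≤ ‖(AᵀA_s + λ²I)⁻¹‖₂ · (‖b‖₂ + ‖A‖₂‖x*‖₂ + ‖A_s‖₂‖x_s*‖₂) · ‖A − A_s‖₂. -/
open Matrix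
noncomputable section

theorem mulVecE_sub {N : ℕ} (A : Matrix (Fin N) (Fin N) ℝ) (x y : EuclideanSpace ℝ (Fin N)) :
    mulVecE A (x - y) = mulVecE A x - mulVecE A y := by
  simp [mulVecE_eq_toEuclideanCLM]

theorem add_mulVecE {N : ℕ} (A B : Matrix (Fin N) (Fin N) ℝ) (x : EuclideanSpace ℝ (Fin N)) :
    mulVecE (A + B) x = mulVecE A x + mulVecE B x := by
  simp [mulVecE_eq_toEuclideanCLM]

theorem sub_mulVecE {N : ℕ} (A B : Matrix (Fin N) (Fin N) ℝ) (x : EuclideanSpace ℝ (Fin N)) :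
    mulVecE (A - B) x = mulVecE A x - mulVecE B x := by
  simp [mulVecE_eq_toEuclideanCLM]

theorem mul_mulVecE {N : ℕ} (A B : Matrix (Fin N) (Fin N) ℝ) (x : EuclideanSpace ℝ (Fin N)) :
    mulVecE (A * B) x = mulVecE A (mulVecE B x) := by
  simp [mulVecE_eq_toEuclideanCLM]

theorem smul_one_mulVecE {N : ℕ} (c : ℝ) (x : EuclideanSpace ℝ (Fin N)) :
    mulVecE (c • (1 : Matrix (Fin N) (Fin N) ℝ)) x = c • x := by
  simp [mulVecE_eq_toEuclideanCLM]

theorem norm_mulVecE_le {N : ℕ} (A : Matrix (Fin N) (Fin N) ℝ) (x : EuclideanSpace ℝ (Fin N)) :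
    ‖mulVecE A x‖ ≤ opNorm A * ‖x‖ :=
  (Matrix.toEuclideanCLM (𝕜 := ℝ) A).le_opNorm x

theorem opNorm_nonneg {N : ℕ} (A : Matrix (Fin N) (Fin N) ℝ) : 0 ≤ opNorm A :=
  norm_nonneg _

theorem opNorm_transpose {N : ℕ} (A : Matrix (Fin N) (Fin N) ℝ) : opNorm Aᵀ = opNorm A := by
  rw [opNorm, opNorm, ← Matrix.conjTranspose_eq_transpose_of_trivial,
    ← Matrix.star_eq_conjTranspose, map_star,
    ContinuousLinearMap.star_eq_adjoint, LinearIsometryEquiv.norm_map]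

/-- The difference of the two minimizers solves a linear system whose right-hand side is
controlled by `A - As`. -/
theorem mulVecE_minimizer_sub {N : ℕ}
    {A As : Matrix (Fin N) (Fin N) ℝ} {b xstar xsstar : EuclideanSpace ℝ (Fin N)} {lam : ℝ}
    (h1 : mulVecE Aᵀ (mulVecE A xstar - b) + lam ^ 2 • xstar = 0)
    (h2 : mulVecE Asᵀ (mulVecE As xsstar - b) + lam ^ 2 • xsstar = 0) :
    mulVecE (Aᵀ * As + lam ^ 2 • (1 : Matrix (Fin N) (Fin N) ℝ)) (xsstar - xstar) =
      mulVecE (A - As)ᵀ (mulVecE As xsstar - b) + mulVecE Aᵀ (mulVecE (A - As) xstar) := by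
  simp only [Matrix.transpose_sub, add_mulVecE, sub_mulVecE, mul_mulVecE, smul_one_mulVecE,
    mulVecE_sub] at h1 h2 ⊢
  linear_combination (norm := module) h2 - h1

/-- If `x*` and `x_s*` satisfy the optimality conditions for `A` and `A_s` and
`AᵀA_s + λ²I` is invertible, then
`‖x_s* − x*‖ ≤ ‖(AᵀA_s + λ²I)⁻¹‖₂ (‖b‖ + ‖A‖₂‖x*‖ + ‖A_s‖₂‖x_s*‖) ‖A − A_s‖₂`. -/
theorem minimizer_distance_bound {N : ℕ}
    (A As : Matrix (Fin N) (Fin N) ℝ) (b xstar xsstar : EuclideanSpace ℝ (Fin N))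
    (lam : ℝ)
    (h1 : mulVecE Aᵀ (mulVecE A xstar - b) + lam ^ 2 • xstar = 0)
    (h2 : mulVecE Asᵀ (mulVecE As xsstar - b) + lam ^ 2 • xsstar = 0)
    (hinv : IsUnit (Aᵀ * As + lam ^ 2 • (1 : Matrix (Fin N) (Fin N) ℝ))) :
    ‖xsstar - xstar‖ ≤
      opNorm (Aᵀ * As + lam ^ 2 • (1 : Matrix (Fin N) (Fin N) ℝ))⁻¹ *
        (‖b‖ + opNorm A * ‖xstar‖ + opNorm As * ‖xsstar‖) * opNorm (A - As) := by
  set M := Aᵀ * As + lam ^ 2 • (1 : Matrix (Fin N) (Fin N) ℝ)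
  have hM : xsstar - xstar = mulVecE M⁻¹ (mulVecE M (xsstar - xstar)) := by
    rw [← mul_mulVecE, Matrix.nonsing_inv_mul M ((Matrix.isUnit_iff_isUnit_det M).mp hinv),
      mulVecE_eq_toEuclideanCLM, map_one, one_apply_eq_self]
  have hres : ‖mulVecE As xsstar - b‖ ≤ opNorm As * ‖xsstar‖ + ‖b‖ :=
    (norm_sub_le _ _).trans (by gcongr; exact norm_mulVecE_le As xsstar)
  have hleft : ‖mulVecE (A - As)ᵀ (mulVecE As xsstar - b)‖ ≤
      opNorm (A - As) * (opNorm As * ‖xsstar‖ + ‖b‖) := by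
    refine (norm_mulVecE_le _ _).trans ?_
    rw [opNorm_transpose]
    exact mul_le_mul_of_nonneg_left hres (opNorm_nonneg _)
  have hright : ‖mulVecE Aᵀ (mulVecE (A - As) xstar)‖ ≤
      opNorm A * (opNorm (A - As) * ‖xstar‖) := by
    refine (norm_mulVecE_le _ _).trans ?_
    rw [opNorm_transpose]
    exact mul_le_mul_of_nonneg_left (norm_mulVecE_le _ _) (opNorm_nonneg _)
  calc ‖xsstar - xstar‖ = ‖mulVecE M⁻¹ (mulVecE M (xsstar - xstar))‖ := congrArg norm hM
    _ ≤ opNorm M⁻¹ * ‖mulVecE M (xsstar - xstar)‖ := norm_mulVecE_le _ _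
    _ ≤ opNorm M⁻¹ * (opNorm (A - As) * (opNorm As * ‖xsstar‖ + ‖b‖) +
          opNorm A * (opNorm (A - As) * ‖xstar‖)) := by
        refine mul_le_mul_of_nonneg_left ?_ (opNorm_nonneg _)
        rw [mulVecE_minimizer_sub h1 h2]
        exact (norm_add_le _ _).trans (add_le_add hleft hright)
    _ = opNorm M⁻¹ * (‖b‖ + opNorm A * ‖xstar‖ + opNorm As * ‖xsstar‖) * opNorm (A - As) := by
        ring
end
end

section
/- Let A, A_s ∈ ℝ^{N×N}, b ∈ ℝ^N, λ ∈ ℝ, and suppose x*, x_s* ∈ ℝ^N satisfy Aᵀ(Ax* − b) + λ²x* = 0 and A_sᵀ(A_s x_s* − b) + λ²x_s* = 0. Let Φ(x) = ½‖Ax−b‖₂² + (λ²/2)‖x‖₂² and Φ_s(x) = ½‖A_s x−b‖₂² + (λ²/2)‖x‖₂². Then for every x̃ ∈ ℝ^N: |Φ(x̃) − Φ(x*)| ≤ |Φ_s(x̃) − Φ_s(x_s*)| + ‖½(A+A_s)x̃ − b‖₂‖x̃‖₂‖A − A_s‖₂ + ½‖b‖₂(‖A‖₂‖x* − x_s*‖₂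 + ‖A − A_s‖₂‖x_s*‖₂). -/
open Matrix
noncomputable section

open scoped InnerProductSpace in
/-- The Tikhonov functional at a stationary point. -/
theorem tikhonov_stationary_value {E F : Type*} [NormedAddCommGroup E] [InnerProductSpace ℝ E]
    [CompleteSpace E] [NormedAddCommGroup F] [InnerProductSpace ℝ F] [CompleteSpace F]
    (T : E →L[ℝ] F) (b : F) (c : ℝ) {x : E}
    (h : ContinuousLinearMap.adjoint T (T x - b) + c • x = 0) :
    1 / 2 * ‖T x - b‖ ^ 2 + c / 2 * ‖x‖ ^ 2 = 1 / 2 * (‖b‖ ^ 2 - ⟪T x, b⟫_ℝ) := by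
  have key : ⟪T x - b, T x⟫_ℝ + c * ‖x‖ ^ 2 = 0 := by
    rw [← ContinuousLinearMap.adjoint_inner_left, ← real_inner_self_eq_norm_sq,
      ← real_inner_smul_left, ← inner_add_left, h, inner_zero_left]
  rw [inner_sub_left, real_inner_self_eq_norm_sq, real_inner_comm] at key
  rw [norm_sub_sq_real]
  linarith

open scoped InnerProductSpace in
/-- Difference of two residual norms with the same right-hand side. -/
theorem norm_sub_sq_sub_norm_sub_sq {F : Type*} [NormedAddCommGroup F] [InnerProductSpace ℝ F]
    (u v b : F) :
    1 / 2 * ‖u - b‖ ^ 2 - 1 / 2 * ‖v - b‖ ^ 2 = ⟪(1 / 2 : ℝ) • (u + v) - b, u - v⟫_ℝ := by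
  rw [norm_sub_sq_real, norm_sub_sq_real]
  simp only [inner_sub_left, inner_sub_right, real_inner_smul_left, inner_add_left,
    real_inner_self_eq_norm_sq, real_inner_comm b, real_inner_comm u v]
  ring

theorem toEuclideanCLM_transpose {N : ℕ} (A : Matrix (Fin N) (Fin N) ℝ) :
    Matrix.toEuclideanCLM (𝕜 := ℝ) Aᵀ =
      ContinuousLinearMap.adjoint (Matrix.toEuclideanCLM (𝕜 := ℝ) A) := by
  rw [← Matrix.conjTranspose_eq_transpose_of_trivial, ← Matrix.star_eq_conjTranspose, map_star,
    ContinuousLinearMap.star_eq_adjoint]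

/-- If `x*` and `x_s*` satisfy the optimality conditions for `A` and `A_s`, then for every `x̃`:
`|Φ(x̃) − Φ(x*)| ≤ |Φ_s(x̃) − Φ_s(x_s*)| + ‖½(A+A_s)x̃ − b‖‖x̃‖‖A − A_s‖₂`
`+ ½‖b‖(‖A‖₂‖x* − x_s*‖ + ‖A − A_s‖₂‖x_s*‖)`. -/
theorem total_error_decomposition {N : ℕ}
    (A As : Matrix (Fin N) (Fin N) ℝ) (b xstar xsstar : EuclideanSpace ℝ (Fin N))
    (lam : ℝ)
    (h1 : mulVecE Aᵀ (mulVecE A xstar - b) + lam ^ 2 • xstar = 0)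
    (h2 : mulVecE Asᵀ (mulVecE As xsstar - b) + lam ^ 2 • xsstar = 0)
    (Φ Φs : EuclideanSpace ℝ (Fin N) → ℝ)
    (hΦ : ∀ z, Φ z = 1 / 2 * ‖mulVecE A z - b‖ ^ 2 + lam ^ 2 / 2 * ‖z‖ ^ 2)
    (hΦs : ∀ z, Φs z = 1 / 2 * ‖mulVecE As z - b‖ ^ 2 + lam ^ 2 / 2 * ‖z‖ ^ 2) :
    ∀ xt : EuclideanSpace ℝ (Fin N),
      |Φ xt - Φ xstar| ≤
        |Φs xt - Φs xsstar|
        + ‖mulVecE ((1 / 2 : ℝ) • (A + As)) xt - b‖ * ‖xt‖ * opNorm (A - As)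
        + 1 / 2 * ‖b‖ * (opNorm A * ‖xstar - xsstar‖ + opNorm (A - As) * ‖xsstar‖) := by
  intro xt
  simp only [opNorm, mulVecE_eq_toEuclideanCLM, toEuclideanCLM_transpose, map_smul, map_add,
    _root_.smul_apply, _root_.add_apply] at *
  rw [map_sub]
  generalize Matrix.toEuclideanCLM (𝕜 := ℝ) A = T at *
  generalize Matrix.toEuclideanCLM (𝕜 := ℝ) As = S at *
  have hx : Φ xstar = _ := (hΦ xstar).trans (tikhonov_stationary_value T b _ h1)
  have hxs : Φs xsstar = _ := (hΦs xsstar).trans (tikhonov_stationary_value S b _ h2)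
  have hres : Φ xt - Φs xt =
      inner ℝ ((1 / 2 : ℝ) • (T xt + S xt) - b) ((T - S) xt) := by
    rw [hΦ, hΦs, _root_.sub_apply, ← norm_sub_sq_sub_norm_sub_sq]
    ring
  have hopt : Φs xsstar - Φ xstar =
      1 / 2 * inner ℝ (T (xstar - xsstar) + (T - S) xsstar) b := by
    have : T (xstar - xsstar) + (T - S) xsstar = T xstar - S xsstar := by
      rw [map_sub, _root_.sub_apply]
      abel
    rw [hx, hxs, this, inner_sub_left]
    ring
  have hres_le : |Φ xt - Φs xt| ≤
      ‖(1 / 2 : ℝ) • (T xt + S xt) - b‖ * ‖xt‖ * ‖T - S‖ := by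
    rw [hres, mul_assoc, mul_comm ‖xt‖]
    exact (abs_real_inner_le_norm _ _).trans
      (mul_le_mul_of_nonneg_left ((T - S).le_opNorm xt) (norm_nonneg _))
  have hopt_le : |Φs xsstar - Φ xstar| ≤
      1 / 2 * ‖b‖ * (‖T‖ * ‖xstar - xsstar‖ + ‖T - S‖ * ‖xsstar‖) := by
    rw [hopt, abs_mul, abs_of_pos (by norm_num : (0 : ℝ) < 1 / 2), mul_assoc, mul_comm ‖b‖]
    refine mul_le_mul_of_nonneg_left ((abs_real_inner_le_norm _ _).trans
      (mul_le_mul_of_nonneg_right ?_ (norm_nonneg _))) (by norm_num)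
    exact (norm_add_le _ _).trans (add_le_add (T.le_opNorm _) ((T - S).le_opNorm _))
  calc |Φ xt - Φ xstar|
      = |(Φs xt - Φs xsstar) + (Φ xt - Φs xt) + (Φs xsstar - Φ xstar)| := by ring_nf
    _ ≤ |Φs xt - Φs xsstar| + |Φ xt - Φs xt| + |Φs xsstar - Φ xstar| := abs_add_three _ _ _
    _ ≤ _ := by gcongr
end
end

section
/- Let P ∈ ℝ^{m×n}, 1 ≤ l ≤ m, 1 ≤ q ≤ n, and define the mn×mn matrix A_P, with rows and columns indexed by pairs (j,i) ∈ {1,…,n}×{1,…,m} consistent with column-stacking vec, by A_P[(j,i),(j',i')] = P_{l+i−i', q+j−j'} when 1 ≤ l+i−i' ≤ m and 1 ≤ q+j−j' ≤ n, and 0 otherwise. If P = ∑_{t=1}^{r} u_t v_tᵀ for vectors u_t ∈ ℝ^m, v_t ∈ ℝ^n, then A_P = ∑_{t=1}^{r} toep(v_t, q) ⊗ toep(u_t, l). -/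
open Matrix
open scoped Kronecker
noncomputable section

/-- The banded Toeplitz matrix `toep(c, l)` (1-based indices): the `(i,j)` entry is
`c_{l+i−j}` when `1 ≤ l+i−j ≤ n` and `0` otherwise. -/
def toep {n : ℕ} (c : Fin n → ℝ) (l : ℕ) : Matrix (Fin n) (Fin n) ℝ :=
  Matrix.of fun i j : Fin n =>
    if h : 1 ≤ l + i.1 - j.1 ∧ l + i.1 - j.1 ≤ n then c ⟨l + i.1 - j.1 - 1, by omega⟩ else 0

/-- The `mn × mn` blurring matrix built from a PSF array `P ∈ ℝ^{m×n}` with (1-based) center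
`(l, q)`: rows and columns are indexed by pairs `(j, i)` (column-stacking convention), and
`A_P[(j,i),(j',i')] = P_{l+i−i', q+j−j'}` when `1 ≤ l+i−i' ≤ m` and `1 ≤ q+j−j' ≤ n`, and `0`
otherwise. -/
def psfMatrix {m n : ℕ} (P : Matrix (Fin m) (Fin n) ℝ) (l q : ℕ) :
    Matrix (Fin n × Fin m) (Fin n × Fin m) ℝ :=
  Matrix.of fun p p' : Fin n × Fin m =>
    if h : (1 ≤ l + p.2.1 - p'.2.1 ∧ l + p.2.1 - p'.2.1 ≤ m) ∧
        (1 ≤ q + p.1.1 - p'.1.1 ∧ q + p.1.1 - p'.1.1 ≤ n) then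
      P ⟨l + p.2.1 - p'.2.1 - 1, by omega⟩ ⟨q + p.1.1 - p'.1.1 - 1, by omega⟩
    else 0

/-- If the PSF array decomposes as `P = ∑_t u_t v_tᵀ`, then the corresponding blurring
matrix decomposes as `A_P = ∑_t toep(v_t, q) ⊗ toep(u_t, l)`. -/
theorem psfMatrix_kronecker_decomposition {m n r : ℕ}
    (P : Matrix (Fin m) (Fin n) ℝ) (l q : ℕ)
    (hl : 1 ≤ l ∧ l ≤ m) (hq : 1 ≤ q ∧ q ≤ n)
    (u : Fin r → (Fin m → ℝ)) (v : Fin r → (Fin n → ℝ))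
    (hP : P = ∑ t, Matrix.vecMulVec (u t) (v t)) :
    psfMatrix P l q = ∑ t, (toep (v t) q) ⊗ₖ (toep (u t) l) := by
  subst hP
  ext ⟨j, i⟩ ⟨j', i'⟩
  simp only [psfMatrix, toep, Matrix.sum_apply, Matrix.kroneckerMap_apply, Matrix.of_apply,
    Matrix.vecMulVec_apply]
  by_cases hi : 1 ≤ l + i.1 - i'.1 ∧ l + i.1 - i'.1 ≤ m
  · by_cases hj : 1 ≤ q + j.1 - j'.1 ∧ q + j.1 - j'.1 ≤ n
    · rw [dif_pos ⟨hi, hj⟩]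
      refine Finset.sum_congr rfl fun t _ => ?_
      rw [dif_pos hi, dif_pos hj, mul_comm]
    · rw [dif_neg fun h => hj h.2]
      refine (Finset.sum_eq_zero fun t _ => ?_).symm
      rw [dif_neg hj, zero_mul]
  · rw [dif_neg fun h => hi h.1]
    refine (Finset.sum_eq_zero fun t _ => ?_).symm
    rw [dif_neg hi, mul_zero]
end
end

section
/- Let n ≥ 1, let 1 ≤ l ≤ n and 1 ≤ q ≤ n, let W_a and W_b be the n×n diagonal matrices with diagonal entries (W_a)_{ii} = √(n − |i − l|) and (W_b)_{jj} = √(n − |j − q|), let {u_1,…,u_n} and {v_1,…,v_n} be orthonormal families in ℝⁿ, and let σ_1,…,σ_n ≥ 0. Set P̄ = ∑_{i=1}^{n} σ_i u_i v_iᵀ, k_i = √σ_i W_a⁻¹ u_i, h_i = √σ_i W_b⁻¹ v_i, K_i = toep(k_i, l), and H_i = toep(h_i, q). Then for every 0 ≤ s ≤ n: ‖∑_{i=1}^{n} K_i ⊗ H_i − ∑_{i=1}^{s} K_i ⊗ H_i‖_F = ‖P̄ − ∑_{i=1}^{s} σ_i u_i v_iᵀ‖_F = √(∑_{i=s+1}^{n}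 σ_i²). -/
open Matrix
open scoped Kronecker
noncomputable section

/-- The Frobenius norm `‖X‖_F = √trace(Xᵀ X)`. -/
def frobNorm {α β : Type*} [Fintype α] [Fintype β] (X : Matrix α β ℝ) : ℝ :=
  Real.sqrt ((Xᵀ * X).trace)

/-- The number of positions on the diagonal `i - j = b - a` of an `n × n` matrix. -/
theorem sum_sum_ite_add_eq_add {n : ℕ} (a b : ℕ) (ha : a ≤ b + n) (hb : b ≤ a + n) :
    (∑ i : Fin n, ∑ j : Fin n, if a + (i : ℕ) = j + b then (1 : ℝ) else 0) =
      n - |(b : ℝ) - a| := by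
  have inner (i : Fin n) : (∑ j : Fin n, if a + (i : ℕ) = j + b then (1 : ℝ) else 0) =
      if b ≤ a + i ∧ a + i < b + n then 1 else 0 := by
    split_ifs with hi
    · rw [Finset.sum_eq_single ⟨a + i - b, by omega⟩]
      · rw [if_pos]
        show a + (i : ℕ) = a + i - b + b
        omega
      · intro j _ hj
        rw [if_neg]
        intro hij
        exact hj (Fin.ext (by show (j : ℕ) = a + i - b; omega))
      · simp
    · refine Finset.sum_eq_zero fun j _ => if_neg ?_
      have := j.isLt
      omega
  simp_rw [inner]
  rw [Fin.sum_univ_eq_sum_range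
    (fun i => if b ≤ a + i ∧ a + i < b + n then (1 : ℝ) else 0) n, Finset.sum_boole]
  have hfilter : (Finset.range n).filter (fun i => b ≤ a + i ∧ a + i < b + n) =
      Finset.Ico (b - a) (min n (b + n - a)) := by
    ext i
    simp only [Finset.mem_filter, Finset.mem_range, Finset.mem_Ico]
    omega
  rw [hfilter, Nat.card_Ico]
  rcases le_total a b with hab | hab
  · rw [abs_of_nonneg (by simpa using hab), show min n (b + n - a) - (b - a) = n + a - b by omega,
      Nat.cast_sub (by omega)]
    push_cast
    ring
  · rw [abs_of_nonpos (by simpa using hab), show min n (b + n - a) - (b - a) = n + b - a by omega,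
      Nat.cast_sub (by omega)]
    push_cast
    ring

theorem toep_mul_toep_apply {n : ℕ} (c d : Fin n → ℝ) (l : ℕ) (i j : Fin n) :
    toep c l i j * toep d l i j =
      ∑ x : Fin n, c x * d x * if l + (i : ℕ) = j + (x + 1 : ℕ) then (1 : ℝ) else 0 := by
  simp only [toep, Matrix.of_apply]
  split_ifs with hij
  · rw [Finset.sum_eq_single ⟨l + i.1 - j.1 - 1, by omega⟩]
    · rw [if_pos, mul_one]
      show l + (i : ℕ) = j + (l + i - j - 1 + 1)
      omega
    · intro x _ hx
      rw [if_neg, mul_zero]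
      intro h
      exact hx (Fin.ext (by show (x : ℕ) = l + i - j - 1; omega))
    · simp
  · rw [mul_zero]
    refine (Finset.sum_eq_zero fun x _ => ?_).symm
    rw [if_neg, mul_zero]
    have := x.isLt
    omega

theorem trace_transpose_toep_mul_toep {n : ℕ} (c d : Fin n → ℝ) {l : ℕ} (hl : 1 ≤ l ∧ l ≤ n) :
    ((toep c l)ᵀ * toep d l).trace =
      ∑ x : Fin n, ((n : ℝ) - |((x : ℕ) : ℝ) + 1 - l|) * (c x * d x) := by
  simp only [Matrix.trace, Matrix.diag_apply, Matrix.mul_apply, Matrix.transpose_apply,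
    toep_mul_toep_apply]
  rw [Finset.sum_comm]
  simp_rw [Finset.sum_comm (s := Finset.univ) (t := (Finset.univ : Finset (Fin n)))
    (f := fun (j x : Fin n) => c x * d x * _)]
  rw [Finset.sum_comm]
  refine Finset.sum_congr rfl fun x _ => ?_
  simp_rw [← Finset.mul_sum]
  rw [sum_sum_ite_add_eq_add _ _ (by omega) (by omega)]
  push_cast
  ring

/-- The Toeplitz matrices of rescaled vectors `√s W⁻¹ y` and `√t W⁻¹ z` have the same Frobenius
inner product as `√s y` and `√t z`. -/
theorem trace_transpose_toep_mul_toep_of_weights {n : ℕ} {l : ℕ} (hl : 1 ≤ l ∧ l ≤ n)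
    {W : Matrix (Fin n) (Fin n) ℝ}
    (hW : W = Matrix.diagonal fun i : Fin n => Real.sqrt ((n : ℝ) - |((i : ℕ) : ℝ) + 1 - (l : ℝ)|))
    (s t : ℝ) (y z : Fin n → ℝ) :
    ((toep (s • W⁻¹.mulVec y) l)ᵀ * toep (t • W⁻¹.mulVec z) l).trace =
      s * t * ∑ x, y x * z x := by
  have hpos (x : Fin n) : 0 < (n : ℝ) - |((x : ℕ) : ℝ) + 1 - (l : ℝ)| := by
    have h1 : ((x : ℕ) : ℝ) + 1 ≤ n := by exact_mod_cast x.isLt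
    have h2 : (1 : ℝ) ≤ l := by exact_mod_cast hl.1
    have h3 : (l : ℝ) ≤ n := by exact_mod_cast hl.2
    have h4 : (0 : ℝ) ≤ (x : ℕ) := Nat.cast_nonneg _
    rw [sub_pos, abs_lt]
    constructor <;> linarith
  have hinv : W⁻¹ = Matrix.diagonal fun i : Fin n =>
      (Real.sqrt ((n : ℝ) - |((i : ℕ) : ℝ) + 1 - (l : ℝ)|))⁻¹ := by
    refine Matrix.inv_eq_right_inv ?_
    rw [hW, Matrix.diagonal_mul_diagonal, ← Matrix.diagonal_one]
    congr 1
    funext i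
    exact mul_inv_cancel₀ (Real.sqrt_pos.mpr (hpos i)).ne'
  rw [trace_transpose_toep_mul_toep _ _ hl, Finset.mul_sum, hinv]
  refine Finset.sum_congr rfl fun x _ => ?_
  simp only [Pi.smul_apply, smul_eq_mul, Matrix.mulVec_diagonal]
  have hsq := Real.mul_self_sqrt (hpos x).le
  have hne := (Real.sqrt_pos.mpr (hpos x)).ne'
  nth_rewrite 1 [← hsq]
  field_simp

/-- Pythagoras for Frobenius-orthogonal matrices: the norm of a tail of their sum. -/
theorem frobNorm_sum_sub_sum_filter {α β : Type*} [Fintype α] [Fintype β] {n : ℕ}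
    (M : Fin n → Matrix α β ℝ) (σ : Fin n → ℝ)
    (hM : ∀ i j, ((M i)ᵀ * M j).trace = if i = j then σ i ^ 2 else 0) (s : ℕ) :
    frobNorm ((∑ i, M i) - ∑ i ∈ Finset.univ.filter fun i : Fin n => (i : ℕ) < s, M i) =
      Real.sqrt (∑ i ∈ Finset.univ.filter fun i : Fin n => s ≤ (i : ℕ), σ i ^ 2) := by
  have htail : (∑ i, M i) - ∑ i ∈ Finset.univ.filter (fun i : Fin n => (i : ℕ) < s), M i =
      ∑ i ∈ Finset.univ.filter (fun i : Fin n => s ≤ (i : ℕ)), M i := by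
    rw [sub_eq_iff_eq_add', ← Finset.sum_filter_add_sum_filter_not _ (fun i : Fin n => (i : ℕ) < s)]
    simp only [not_lt]
  rw [htail, frobNorm, Matrix.transpose_sum, Matrix.sum_mul, Matrix.trace_sum]
  congr 1
  refine Finset.sum_congr rfl fun i hi => ?_
  rw [Matrix.mul_sum, Matrix.trace_sum]
  simp_rw [hM]
  rw [Finset.sum_ite_eq, if_pos hi]

/-- Kronecker-product truncation error: with `K_i = toep(√σ_i W_a⁻¹ u_i, l)`,
`H_i = toep(√σ_i W_b⁻¹ v_i, q)` built from orthonormal families `u`, `v` and singular values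
`σ_i ≥ 0`, and `P̄ = ∑ σ_i u_i v_iᵀ`, for every `0 ≤ s ≤ n`:
`‖∑_{i=1}^n K_i ⊗ H_i − ∑_{i=1}^s K_i ⊗ H_i‖_F = ‖P̄ − ∑_{i=1}^s σ_i u_i v_iᵀ‖_F
  = √(∑_{i=s+1}^n σ_i²)`. -/
theorem kronecker_truncation_error {n : ℕ} (hn : 1 ≤ n)
    (l q : ℕ) (hl : 1 ≤ l ∧ l ≤ n) (hq : 1 ≤ q ∧ q ≤ n)
    (u v : Fin n → (Fin n → ℝ)) (σ : Fin n → ℝ) (hσ : ∀ i, 0 ≤ σ i)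
    (hu : ∀ i j, (∑ x, u i x * u j x) = if i = j then (1 : ℝ) else 0)
    (hv : ∀ i j, (∑ x, v i x * v j x) = if i = j then (1 : ℝ) else 0)
    (Wa Wb : Matrix (Fin n) (Fin n) ℝ)
    (hWa : Wa = Matrix.diagonal fun i : Fin n => Real.sqrt ((n : ℝ) - |((i : ℕ) : ℝ) + 1 - (l : ℝ)|))
    (hWb : Wb = Matrix.diagonal fun j : Fin n => Real.sqrt ((n : ℝ) - |((j : ℕ) : ℝ) + 1 - (q : ℝ)|))
    (k h : Fin n → (Fin n → ℝ))
    (hk : ∀ i, k i = Real.sqrt (σ i) • (Wa⁻¹).mulVec (u i))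
    (hh : ∀ i, h i = Real.sqrt (σ i) • (Wb⁻¹).mulVec (v i))
    (K H : Fin n → Matrix (Fin n) (Fin n) ℝ)
    (hK : ∀ i, K i = toep (k i) l) (hH : ∀ i, H i = toep (h i) q)
    (Pbar : Matrix (Fin n) (Fin n) ℝ)
    (hPbar : Pbar = ∑ i, σ i • Matrix.vecMulVec (u i) (v i)) :
    ∀ s : ℕ, s ≤ n →
      frobNorm ((∑ i, (K i) ⊗ₖ (H i)) -
          ∑ i ∈ Finset.univ.filter fun i : Fin n => (i : ℕ) < s, (K i) ⊗ₖ (H i)) =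
        frobNorm (Pbar -
          ∑ i ∈ Finset.univ.filter fun i : Fin n => (i : ℕ) < s,
            σ i • Matrix.vecMulVec (u i) (v i)) ∧
      frobNorm ((∑ i, (K i) ⊗ₖ (H i)) -
          ∑ i ∈ Finset.univ.filter fun i : Fin n => (i : ℕ) < s, (K i) ⊗ₖ (H i)) =
        Real.sqrt (∑ i ∈ Finset.univ.filter fun i : Fin n => s ≤ (i : ℕ), σ i ^ 2) := by
  intro s _
  have hKron (i j : Fin n) : ((K i ⊗ₖ H i)ᵀ * (K j ⊗ₖ H j)).trace =
      if i = j then σ i ^ 2 else 0 := by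
    rw [← Matrix.kroneckerMap_transpose, ← Matrix.mul_kronecker_mul, Matrix.trace_kronecker,
      hK, hK, hH, hH, hk, hk, hh, hh, trace_transpose_toep_mul_toep_of_weights hl hWa,
      trace_transpose_toep_mul_toep_of_weights hq hWb, hu, hv]
    split_ifs with hij
    · subst hij
      rw [Real.mul_self_sqrt (hσ i)]
      ring
    · ring
  have hRankOne (i j : Fin n) : ((σ i • Matrix.vecMulVec (u i) (v i))ᵀ *
      (σ j • Matrix.vecMulVec (u j) (v j))).trace = if i = j then σ i ^ 2 else 0 := by
    have hdot : u i ⬝ᵥ u j = if i = j then (1 : ℝ) else 0 := hu i j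
    have hdot' : v i ⬝ᵥ v j = if i = j then (1 : ℝ) else 0 := hv i j
    rw [Matrix.transpose_smul, Matrix.transpose_vecMulVec, Matrix.smul_mul, Matrix.mul_smul,
      Matrix.vecMulVec_mul_vecMulVec, Matrix.trace_smul, Matrix.trace_smul,
      Matrix.trace_vecMulVec, dotProduct_smul, hdot, hdot']
    split_ifs with hij
    · subst hij
      simp [sq]
    · simp
  have hleft := frobNorm_sum_sub_sum_filter _ σ hKron s
  subst hPbar
  exact ⟨hleft.trans (frobNorm_sum_sub_sum_filter _ σ hRankOne s).symm, hleft⟩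
end
end
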